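/- Let n ≥ 4 be a natural and t ∈ {1, 2, 3}, and suppose there exists a real Hadamard matrix of order 4n. Then there exists a real orthogonal matrix Y of order 4n − t such that every entry of Y satisfies (1 − ρ_t/√n)/√(4n−t) ≤ |Y_{ij}| ≤ (1 + ρ_t/√n)/√(4n−t), where ρ₁ = 1/2, ρ₂ = 2, and ρ₃ = 4. -/

import Mathlib

open Matrix

section Feedback

variable {α β : Type*} [Fintype α] [Fintype β] [DecidableEq α] [DecidableEq β]

/-- Closing the first block of an orthogonal block matrix by feedback keeps orthogonality. -/
lemma feedback_mul_transpose {A : Matrix α α ℝ} {B : Matrix α β ℝ} {C : Matrix β α ℝ}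
    {D : Matrix β β ℝ} {M : Matrix α α ℝ} (hAB : A * Aᵀ + B * Bᵀ = 1)
    (hBD : A * Cᵀ + B * Dᵀ = 0) (hCD : C * Cᵀ + D * Dᵀ = 1) (hM : M * (1 + A) = 1) :
    (D - C * M * B) * (D - C * M * B)ᵀ = 1 := by
  have hMA : M * A = 1 - M := by
    rw [mul_add, mul_one] at hM
    exact eq_sub_of_add_eq' hM
  have hMA' : Aᵀ * Mᵀ = 1 - Mᵀ := by
    rw [← transpose_mul, hMA, transpose_sub, transpose_one]
  have hBD' : B * Dᵀ = -(A * Cᵀ) := eq_neg_of_add_eq_zero_right hBD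
  have hDB' : D * Bᵀ = -(C * Aᵀ) := by
    simpa [transpose_mul] using congrArg transpose hBD'
  have hDD : D * Dᵀ = 1 - C * Cᵀ := eq_sub_of_add_eq' hCD
  have hBB : B * Bᵀ = 1 - A * Aᵀ := eq_sub_of_add_eq' hAB
  have expand : (D - C * M * B) * (D - C * M * B)ᵀ =
      D * Dᵀ - C * (M * (B * Dᵀ)) - D * Bᵀ * (Mᵀ * Cᵀ)
        + C * (M * (B * Bᵀ) * Mᵀ) * Cᵀ := by
    simp only [transpose_sub, transpose_mul, Matrix.sub_mul, Matrix.mul_sub, Matrix.mul_assoc]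
    abel
  have key : M * (1 - A * Aᵀ) * Mᵀ = M + Mᵀ - 1 := by
    have : M * (1 - A * Aᵀ) * Mᵀ = M * Mᵀ - (M * A) * (Aᵀ * Mᵀ) := by
      noncomm_ring
    rw [this, hMA, hMA']
    noncomm_ring
  have h1 : C * (M * -(A * Cᵀ)) = -(C * (M * A) * Cᵀ) := by
    simp only [Matrix.mul_neg, Matrix.mul_assoc]
  have h2 : -(C * Aᵀ) * (Mᵀ * Cᵀ) = -(C * (Aᵀ * Mᵀ) * Cᵀ) := by
    simp only [Matrix.neg_mul, Matrix.mul_assoc]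
  rw [expand, hBD', hDB', hDD, hBB, key, h1, h2, hMA, hMA']
  simp only [Matrix.mul_sub, Matrix.sub_mul, Matrix.mul_add, Matrix.add_mul, Matrix.mul_one]
  abel

end Feedback

lemma dotProduct_sq_le {α : Type*} [Fintype α] (x y : α → ℝ) :
    (x ⬝ᵥ y) ^ 2 ≤ (x ⬝ᵥ x) * (y ⬝ᵥ y) := by
  simpa [dotProduct, pow_two] using Finset.sum_mul_sq_le_sq_mul_sq Finset.univ x y

/-- A solution of a coercive linear system has controlled pairings. -/
lemma abs_dotProduct_le_of_coercive {α : Type*} [Fintype α] {γ b : ℝ} (hγ : 0 < γ) (hb : 0 ≤ b)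
    {K : Matrix α α ℝ} (hK : ∀ x, γ * (x ⬝ᵥ x) ≤ x ⬝ᵥ K *ᵥ x) {x u c : α → ℝ}
    (hx : K *ᵥ x = u) (hu : u ⬝ᵥ u = b) (hc : c ⬝ᵥ c = b) : |c ⬝ᵥ x| ≤ b / γ := by
  have h0 : 0 ≤ x ⬝ᵥ x := Finset.sum_nonneg fun i _ => mul_self_nonneg (x i)
  have h1 := hK x
  rw [hx] at h1
  have h2 := dotProduct_sq_le x u
  have h3 := dotProduct_sq_le c x
  rw [hu] at h2
  rw [hc] at h3
  have h4 : γ ^ 2 * (x ⬝ᵥ x) ≤ b := by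
    rcases h0.eq_or_lt with h | h
    · rw [← h]; simpa using hb
    · have h5 : (γ * (x ⬝ᵥ x)) ^ 2 ≤ (x ⬝ᵥ x) * b :=
        (pow_le_pow_left₀ (by positivity) h1 2).trans h2
      refine le_of_mul_le_mul_left ?_ h
      linarith [h5]
  have hbγ : 0 ≤ b / γ := by positivity
  refine abs_le_of_sq_le_sq ?_ hbγ
  rw [div_pow, le_div_iff₀ (by positivity)]
  nlinarith [mul_le_mul_of_nonneg_left h4 hb, mul_le_mul_of_nonneg_right h3 (sq_nonneg γ)]

/-- The quadratic form of a sign matrix with unit diagonal. -/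
lemma sign_quadratic_form_lower_bound {α : Type*} [Fintype α] [DecidableEq α]
    {S : Matrix α α ℝ} (hS : ∀ i j, |S i j| ≤ 1) (hd : ∀ i, S i i = 1) (x : α → ℝ) :
    (2 - (Fintype.card α : ℝ)) * (x ⬝ᵥ x) ≤ x ⬝ᵥ S *ᵥ x := by
  have h1 : ∀ i j, (if i = j then 2 * (x i * x i) else 0) - (x i * x i + x j * x j) / 2
      ≤ x i * (S i j * x j) := by
    intro i j
    split_ifs with h
    · subst h
      rw [hd]
      linarith
    · obtain ⟨h2, h3⟩ := abs_le.mp (hS i j)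
      nlinarith [mul_nonneg (sub_nonneg.mpr h3) (sq_nonneg (x i - x j)),
        mul_nonneg (neg_le_iff_add_nonneg.mp h2) (sq_nonneg (x i + x j))]
  have h2 := Finset.sum_le_sum fun i (_ : i ∈ Finset.univ) =>
    Finset.sum_le_sum fun j (_ : j ∈ Finset.univ) => h1 i j
  have h3 : x ⬝ᵥ S *ᵥ x = ∑ i, ∑ j, x i * (S i j * x j) := by
    simp [dotProduct, mulVec, Finset.mul_sum]
  rw [h3]
  refine le_of_eq_of_le ?_ h2
  simp only [Finset.sum_sub_distrib, Finset.sum_ite_eq, Finset.mem_univ, if_true,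
    ← Finset.sum_div, Finset.sum_add_distrib, Finset.sum_const, Finset.card_univ, nsmul_eq_mul,
    ← Finset.mul_sum, dotProduct]
  ring

/-- Contracting the corner `α` of a sign matrix with orthogonal rows and unit diagonal on `α`. -/
lemma exists_orthogonal_of_sign_matrix {α β : Type*} [Fintype α] [Fintype β] [DecidableEq α]
    [DecidableEq β] {s : ℝ} (hs : 0 < s) (hγ : 0 < s + 2 - (Fintype.card α : ℝ))
    {H : Matrix (α ⊕ β) (α ⊕ β) ℝ} (hH : ∀ i j, |H i j| = 1) (hHH : H * Hᵀ = (s ^ 2) • 1)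
    (hd : ∀ i : α, H (.inl i) (.inl i) = 1) :
    ∃ Y : Matrix β β ℝ, Y * Yᵀ = 1 ∧ ∀ i j,
      1 / s - Fintype.card α / (s * (s + 2 - Fintype.card α)) ≤ |Y i j| ∧
      |Y i j| ≤ 1 / s + Fintype.card α / (s * (s + 2 - Fintype.card α)) := by
  set U : Matrix (α ⊕ β) (α ⊕ β) ℝ := s⁻¹ • H with hU
  have hUU : U * Uᵀ = 1 := by
    rw [hU, transpose_smul, smul_mul_smul_comm, hHH, smul_smul]
    have : s⁻¹ * s⁻¹ * s ^ 2 = 1 := by field_simp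
    rw [this, one_smul]
  have habs : ∀ i j, |U i j| = 1 / s := fun i j => by
    simp [hU, abs_mul, hH, abs_of_pos hs]
  have hsq : ∀ i j, U i j * U i j = 1 / s ^ 2 := fun i j => by
    rw [← abs_mul_abs_self, habs]; field_simp
  rw [← fromBlocks_toBlocks U, fromBlocks_transpose, fromBlocks_multiply, ← fromBlocks_one,
    fromBlocks_inj] at hUU
  obtain ⟨hAB, hBD, -, hCD⟩ := hUU
  set γ : ℝ := 1 + (2 - Fintype.card α) / s with hγdef
  have hγs : γ = (s + 2 - Fintype.card α) / s := by rw [hγdef]; field_simp; ring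
  have hγ0 : 0 < γ := by rw [hγs]; positivity
  have hK : ∀ x : α → ℝ, γ * (x ⬝ᵥ x) ≤ x ⬝ᵥ (1 + U.toBlocks₁₁) *ᵥ x := by
    intro x
    have h1 := sign_quadratic_form_lower_bound (S := H.toBlocks₁₁) (fun i j => (hH _ _).le) hd x
    have h2 : U.toBlocks₁₁ = s⁻¹ • H.toBlocks₁₁ := rfl
    rw [add_mulVec, one_mulVec, dotProduct_add, h2, smul_mulVec, dotProduct_smul, smul_eq_mul]
    have h3 := mul_le_mul_of_nonneg_left h1 (inv_pos.mpr hs).le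
    rw [hγdef, div_eq_inv_mul]
    linarith
  have hdet : IsUnit (1 + U.toBlocks₁₁).det := by
    rw [isUnit_iff_ne_zero]
    intro h
    obtain ⟨v, hv, hv0⟩ := exists_mulVec_eq_zero_iff.mpr h
    have h1 := hK v
    rw [hv0, dotProduct_zero] at h1
    have h2 : 0 ≤ v ⬝ᵥ v := Finset.sum_nonneg fun i _ => mul_self_nonneg (v i)
    exact hv (dotProduct_self_eq_zero.mp (le_antisymm (by nlinarith) h2))
  refine ⟨_, feedback_mul_transpose hAB hBD hCD (nonsing_inv_mul _ hdet), fun i j => ?_⟩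
  have hent : (U.toBlocks₂₁ * (1 + U.toBlocks₁₁)⁻¹ * U.toBlocks₁₂) i j
      = U.toBlocks₂₁ i ⬝ᵥ ((1 + U.toBlocks₁₁)⁻¹ *ᵥ fun k => U.toBlocks₁₂ k j) := by
    rw [Matrix.mul_assoc]; rfl
  have hbound := abs_dotProduct_le_of_coercive (b := Fintype.card α / s ^ 2) hγ0 (by positivity) hK
    (x := (1 + U.toBlocks₁₁)⁻¹ *ᵥ fun k => U.toBlocks₁₂ k j)
    (u := fun k => U.toBlocks₁₂ k j) (c := U.toBlocks₂₁ i)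
    (by rw [mulVec_mulVec, mul_nonsing_inv _ hdet, one_mulVec])
    (by simp [dotProduct, toBlocks₁₂, hsq, div_eq_mul_inv])
    (by simp [dotProduct, toBlocks₂₁, hsq, div_eq_mul_inv])
  have hval : (Fintype.card α : ℝ) / s ^ 2 / γ
      = Fintype.card α / (s * (s + 2 - Fintype.card α)) := by
    rw [hγs]; field_simp
  rw [hval, ← hent] at hbound
  have hD : |U.toBlocks₂₂ i j| = 1 / s := habs _ _
  rw [Matrix.sub_apply]
  have h1 := abs_sub_abs_le_abs_sub (U.toBlocks₂₂ i j)
    ((U.toBlocks₂₁ * (1 + U.toBlocks₁₁)⁻¹ * U.toBlocks₁₂) i j)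
  have h2 := abs_sub (U.toBlocks₂₂ i j)
    ((U.toBlocks₂₁ * (1 + U.toBlocks₁₁)⁻¹ * U.toBlocks₁₂) i j)
  constructor <;> linarith

/-- Negating rows of a real Hadamard matrix makes its diagonal constant. -/
lemma exists_sign_matrix_diag_one {ι : Type*} [Fintype ι] [DecidableEq ι] {c : ℝ}
    {H : Matrix ι ι ℝ} (hH : ∀ i j, H i j = 1 ∨ H i j = -1) (hHH : H * Hᵀ = c • 1) :
    ∃ G : Matrix ι ι ℝ, (∀ i j, |G i j| = 1) ∧ G * Gᵀ = c • 1 ∧ ∀ i, G i i = 1 := by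
  have hsq : ∀ i, H i i * H i i = 1 := fun i => by rcases hH i i with h | h <;> norm_num [h]
  refine ⟨diagonal (fun i => H i i) * H, fun i j => ?_, ?_, fun i => ?_⟩
  · rw [diagonal_mul]
    rcases hH i i with h | h <;> rcases hH i j with h' | h' <;> norm_num [h, h']
  · rw [transpose_mul, diagonal_transpose, Matrix.mul_assoc, ← Matrix.mul_assoc H, hHH]
    simp [hsq]
  · rw [diagonal_mul, hsq]

/-- The real inequalities behind the entrywise estimate, with `s` the square root of the order. -/
lemma entry_bounds {t : ℕ} (ht : t = 1 ∨ t = 2 ∨ t = 3) {s r ρ : ℝ} (hs : 4 ≤ s) (hr : 0 < r)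
    (hrs : r ^ 2 = s ^ 2 - t) (hρ : ρ = if t = 1 then 1 / 2 else if t = 2 then 2 else 4) :
    (1 - ρ / (s / 2)) / r ≤ 1 / s - t / (s * (s + 2 - t)) ∧
      1 / s + t / (s * (s + 2 - t)) ≤ (1 + ρ / (s / 2)) / r := by
  have hs0 : 0 < s := by linarith
  have hle : r ≤ s := by
    have : (0 : ℝ) ≤ t := by positivity
    nlinarith
  have ht3 : (t : ℝ) ≤ 3 := by rcases ht with rfl | rfl | rfl <;> norm_num
  have hge : s - 1 ≤ r := by nlinarith
  have hq : 0 < s + 2 - t := by linarith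
  have hlow : 1 / s - t / (s * (s + 2 - t)) = (s + 2 - 2 * t) / (s * (s + 2 - t)) := by
    field_simp; ring
  have hupp : 1 / s + t / (s * (s + 2 - t)) = (s + 2) / (s * (s + 2 - t)) := by
    field_simp; ring
  have e1 : (1 - ρ / (s / 2)) / r = (s - 2 * ρ) / (s * r) := by field_simp
  have e2 : (1 + ρ / (s / 2)) / r = (s + 2 * ρ) / (s * r) := by field_simp
  rw [hlow, hupp, e1, e2, div_le_div_iff₀ (by positivity) (by positivity),
    div_le_div_iff₀ (by positivity) (by positivity)]
  have l1 : (s - 2 * ρ) * (s + 2 - t) ≤ (s + 2 - 2 * t) * r := by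
    rcases ht with rfl | rfl | rfl <;> norm_num at hρ hrs ⊢ <;> subst hρ <;> nlinarith
  have l2 : (s + 2) * s ≤ (s + 2 * ρ) * (s + 2 - t) := by
    rcases ht with rfl | rfl | rfl <;> norm_num at hρ ⊢ <;> subst hρ <;> nlinarith
  have l3 : (s + 2) * r ≤ (s + 2) * s := by gcongr
  constructor <;> nlinarith [mul_le_mul_of_nonneg_left l1 hs0.le,
    mul_le_mul_of_nonneg_left (l3.trans l2) hs0.le]

theorem stmt_17 (n t : ℕ) (hn : 4 ≤ n) (ht : t ∈ ({1, 2, 3} : Set ℕ))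
    (hH : ∃ H : Matrix (Fin (4 * n)) (Fin (4 * n)) ℝ,
        (∀ i j, H i j = 1 ∨ H i j = -1) ∧ H * Hᵀ = (4 * (n : ℝ)) • 1) :
    ∃ Y : Matrix (Fin (4 * n - t)) (Fin (4 * n - t)) ℝ,
      Y * Yᵀ = 1 ∧
      ∀ i j,
        (1 - (if t = 1 then (1 / 2 : ℝ) else if t = 2 then 2 else 4) / Real.sqrt n) /
            Real.sqrt (4 * (n : ℝ) - t) ≤ |Y i j| ∧
        |Y i j| ≤ (1 + (if t = 1 then (1 / 2 : ℝ) else if t = 2 then 2 else 4) / Real.sqrt n) /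
            Real.sqrt (4 * (n : ℝ) - t) := by
  obtain ⟨H, hH, hHH⟩ := hH
  obtain ⟨G, hG, hGG, hGd⟩ := exists_sign_matrix_diag_one hH hHH
  have ht' : t = 1 ∨ t = 2 ∨ t = 3 := by simpa using ht
  have ht3 : t ≤ 3 := by omega
  have hn' : (4 : ℝ) ≤ n := by exact_mod_cast hn
  have ht3' : (t : ℝ) ≤ 3 := by exact_mod_cast ht3
  have hsn : Real.sqrt n ^ 2 = n := Real.sq_sqrt (by positivity)
  have hsqrt : 2 ≤ Real.sqrt n := Real.le_sqrt_of_sq_le (by linarith)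
  have hs2 : (2 * Real.sqrt n) ^ 2 = 4 * n := by rw [mul_pow, hsn]; norm_num
  let e : Fin t ⊕ Fin (4 * n - t) ≃ Fin (4 * n) :=
    finSumFinEquiv.trans (finCongr (by omega))
  have hsub : G.submatrix e e * (G.submatrix e e)ᵀ = ((2 * Real.sqrt n) ^ 2) • 1 := by
    rw [transpose_submatrix, submatrix_mul_equiv, hGG, hs2]
    exact congrArg ((4 * (n : ℝ)) • ·) (submatrix_one_equiv (α := ℝ) e)
  obtain ⟨Y, hY, hYb⟩ := exists_orthogonal_of_sign_matrix (s := 2 * Real.sqrt n) (by positivity)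
    (by rw [Fintype.card_fin]; linarith) (fun i j => hG (e i) (e j)) hsub (fun i => hGd _)
  have hb := entry_bounds ht' (s := 2 * Real.sqrt n) (r := Real.sqrt (4 * (n : ℝ) - t))
    (by linarith) (Real.sqrt_pos.mpr (by linarith))
    (by rw [hs2, Real.sq_sqrt (by linarith)]) rfl
  rw [mul_div_cancel_left₀ _ (two_ne_zero' ℝ)] at hb
  refine ⟨Y, hY, fun i j => ?_⟩
  have h := hYb i j
  rw [Fintype.card_fin] at h
  exact ⟨hb.1.trans h.1, h.2.trans hb.2⟩
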